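/- Let x^(1), …, x^(k) be rational time series and let w_1, …, w_k be positive rational weights. Then every real-valued time series z minimizing the weighted Fréchet function F_w(z) = Σ_{j=1}^k w_j · dtw(z, x^(j))² over all finite real time series has all entries rational. In particular, for rational inputs every weighted mean is a rational time series. -/

import Mathlib

/-- A warping path of order `m × n` (pairs are 1-indexed): it starts at `(1,1)`,
ends at `(m,n)`, stays within `[m] × [n]`, and each step is one of
`(+1,0)`, `(0,+1)`, `(+1,+1)`. -/
def IsWarpingPath (m n : ℕ) (p : List (ℕ × ℕ)) : Prop :=
  p.head? = some (1, 1) ∧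
  p.getLast? = some (m, n) ∧
  (∀ q ∈ p, 1 ≤ q.1 ∧ q.1 ≤ m ∧ 1 ≤ q.2 ∧ q.2 ≤ n) ∧
  ∀ ℓ : ℕ, ℓ + 1 < p.length →
    ((p.getD (ℓ + 1) (0, 0)).1 = (p.getD ℓ (0, 0)).1 + 1 ∧
       (p.getD (ℓ + 1) (0, 0)).2 = (p.getD ℓ (0, 0)).2) ∨
    ((p.getD (ℓ + 1) (0, 0)).1 = (p.getD ℓ (0, 0)).1 ∧
       (p.getD (ℓ + 1) (0, 0)).2 = (p.getD ℓ (0, 0)).2 + 1) ∨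
    ((p.getD (ℓ + 1) (0, 0)).1 = (p.getD ℓ (0, 0)).1 + 1 ∧
       (p.getD (ℓ + 1) (0, 0)).2 = (p.getD ℓ (0, 0)).2 + 1)

/-- The cost `C_p(x,y)` of aligning time series `x` and `y` (1-indexed, given as
lists of rationals) along the warping path `p`. -/
def alignCost (x y : List ℚ) (p : List (ℕ × ℕ)) : ℚ :=
  (p.map fun q => (x.getD (q.1 - 1) 0 - y.getD (q.2 - 1) 0) ^ 2).sum

/-- The squared dtw-distance: the minimum alignment cost over all warping paths
of order `x.length × y.length`. -/
noncomputable def dtwSq (x y : List ℚ) : ℝ :=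
  sInf {c : ℝ | ∃ p : List (ℕ × ℕ),
    IsWarpingPath x.length y.length p ∧ c = (alignCost x y p : ℝ)}

/-- The dtw-distance. -/
noncomputable def dtw (x y : List ℚ) : ℝ := Real.sqrt (dtwSq x y)

/-- The cost of aligning two real-valued time series along `p`. -/
def alignCostR (x y : List ℝ) (p : List (ℕ × ℕ)) : ℝ :=
  (p.map fun q => (x.getD (q.1 - 1) 0 - y.getD (q.2 - 1) 0) ^ 2).sum

/-- Squared dtw-distance for real-valued time series. -/
noncomputable def dtwSqR (x y : List ℝ) : ℝ :=
  sInf {c : ℝ | ∃ p : List (ℕ × ℕ),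
    IsWarpingPath x.length y.length p ∧ c = alignCostR x y p}

/-- Along a warping path the coordinate sum grows by at least one in each step. -/
theorem IsWarpingPath.add_two_le {m n : ℕ} {p : List (ℕ × ℕ)} (hp : IsWarpingPath m n p)
    (l : ℕ) (hl : l < p.length) :
    l + 2 ≤ (p.getD l (0, 0)).1 + (p.getD l (0, 0)).2 := by
  obtain ⟨-, -, hb, hs⟩ := hp
  induction l with
  | zero =>
    have h := hb p[0] (List.getElem_mem hl)
    rw [List.getD_eq_getElem _ _ hl]
    omega
  | succ l ih =>
    have h1 := ih (by omega)
    have h2 := hs l hl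
    omega

theorem IsWarpingPath.length_le {m n : ℕ} {p : List (ℕ × ℕ)} (hp : IsWarpingPath m n p) :
    p.length ≤ m + n := by
  by_contra! h
  have h1 := hp.add_two_le (p.length - 1) (by omega)
  rw [List.getD_eq_getElem _ _ (by omega)] at h1
  have h2 := hp.2.2.1 _ (List.getElem_mem (l := p) (n := p.length - 1) (by omega))
  omega

theorem finite_setOf_isWarpingPath (m n : ℕ) : {p | IsWarpingPath m n p}.Finite := by
  let f : Fin (m + 1) × Fin (n + 1) → ℕ × ℕ := fun q => (q.1, q.2)
  refine ((List.finite_length_le _ (m + n)).image (List.map f)).subset fun p hp => ?_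
  have hr : p ∈ Set.range (List.map f) := by
    rw [Set.range_list_map]
    intro q hq
    have h := hp.2.2.1 q hq
    exact ⟨(⟨q.1, by omega⟩, ⟨q.2, by omega⟩), rfl⟩
  obtain ⟨l, rfl⟩ := hr
  exact ⟨l, by simpa using hp.length_le, rfl⟩

/-- A warping path can be prolonged by one horizontal or vertical step. -/
theorem IsWarpingPath.concat {m n m' n' : ℕ} {p : List (ℕ × ℕ)} (hp : IsWarpingPath m n p)
    (h : (m' = m + 1 ∧ n' = n) ∨ (m' = m ∧ n' = n + 1)) :
    IsWarpingPath m' n' (p ++ [(m', n')]) := by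
  obtain ⟨h0, h1, hb, hs⟩ := hp
  have hne : p ≠ [] := by rintro rfl; simp at h0
  have hpos : 0 < p.length := List.length_pos_iff.2 hne
  have hlast : p.getD (p.length - 1) (0, 0) = (m, n) := by
    rw [List.getLast?_eq_getElem?] at h1
    simp [List.getD_eq_getElem?_getD, h1]
  have hmn := hb (m, n) (List.mem_of_getLast? h1)
  refine ⟨by simp [List.head?_append, h0], by simp, fun q hq => ?_, fun l hl => ?_⟩
  · rcases List.mem_append.1 hq with hq | hq
    · have := hb q hq
      omega
    · obtain rfl := List.mem_singleton.1 hq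
      dsimp only at hmn ⊢
      omega
  · simp only [List.length_append, List.length_singleton] at hl
    rw [List.getD_append _ _ _ l (by omega)]
    rcases Nat.lt_or_ge (l + 1) p.length with hl' | hl'
    · rw [List.getD_append _ _ _ _ hl']
      exact hs l hl'
    · obtain rfl : l = p.length - 1 := by omega
      rw [List.getD_append_right _ _ _ _ hl', hlast, Nat.sub_add_cancel hpos]
      simp only [Nat.sub_self, List.getD_cons_zero]
      omega

theorem exists_isWarpingPath {m n : ℕ} (hm : 1 ≤ m) (hn : 1 ≤ n) :
    ∃ p, IsWarpingPath m n p := by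
  induction m, hm using Nat.le_induction with
  | base =>
    induction n, hn using Nat.le_induction with
    | base => exact ⟨[(1, 1)], by simp [IsWarpingPath]⟩
    | succ n _ ih => exact ih.imp' _ fun p hp => hp.concat (Or.inr ⟨rfl, rfl⟩)
  | succ m _ ih => exact ih.imp' _ fun p hp => hp.concat (Or.inl ⟨rfl, rfl⟩)

/-- Every row index occurs in a warping path. -/
theorem IsWarpingPath.exists_mem_fst_eq {m n : ℕ} {p : List (ℕ × ℕ)} (hp : IsWarpingPath m n p)
    {i : ℕ} (hi : 1 ≤ i) (him : i ≤ m) : ∃ q ∈ p, q.1 = i := by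
  obtain ⟨h0, h1, -, hs⟩ := hp
  have hex : ∃ l, l < p.length ∧ i ≤ (p.getD l (0, 0)).1 := by
    rw [List.getLast?_eq_getElem?] at h1
    obtain ⟨hl, -⟩ := List.getElem?_eq_some_iff.1 h1
    exact ⟨p.length - 1, hl, by simpa [List.getD_eq_getElem?_getD, h1] using him⟩
  classical
  obtain ⟨hl, hle⟩ := Nat.find_spec hex
  refine ⟨p.getD (Nat.find hex) (0, 0), ?_, ?_⟩
  · rw [List.getD_eq_getElem _ _ hl]
    exact List.getElem_mem hl
  · rcases hf : Nat.find hex with _ | l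
    · rw [hf] at hle
      rw [List.head?_eq_getElem?] at h0
      simp only [List.getD_eq_getElem?_getD, h0, Option.getD_some] at hle ⊢
      omega
    · have hlt := Nat.find_min hex (m := l) (by omega)
      rw [hf] at hl hle
      have := hs l hl
      have : ¬ i ≤ (p.getD l (0, 0)).1 := fun h => hlt ⟨by omega, h⟩
      omega

theorem dtwSqR_le_alignCostR {x y : List ℝ} {p : List (ℕ × ℕ)}
    (hp : IsWarpingPath x.length y.length p) : dtwSqR x y ≤ alignCostR x y p := by
  refine csInf_le ⟨0, ?_⟩ ⟨p, hp, rfl⟩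
  rintro _ ⟨q, -, rfl⟩
  refine List.sum_nonneg fun a ha => ?_
  obtain ⟨_, -, rfl⟩ := List.mem_map.1 ha
  positivity

theorem exists_dtwSqR_eq_alignCostR {x y : List ℝ} (hx : x ≠ []) (hy : y ≠ []) :
    ∃ p, IsWarpingPath x.length y.length p ∧ dtwSqR x y = alignCostR x y p := by
  obtain ⟨p, hp⟩ := exists_isWarpingPath (List.length_pos_iff.2 hx) (List.length_pos_iff.2 hy)
  refine Set.Nonempty.csInf_mem
    (s := {c : ℝ | ∃ p, IsWarpingPath x.length y.length p ∧ c = alignCostR x y p})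
    ⟨_, p, hp, rfl⟩
    (((finite_setOf_isWarpingPath x.length y.length).image (alignCostR x y)).subset ?_)
  rintro _ ⟨q, hq, rfl⟩
  exact ⟨q, hq, rfl⟩

/-- The alignment cost along a fixed list of pairs is, as a function of a single entry of the
first series, a quadratic polynomial whose two leading coefficients are rational. -/
theorem exists_alignCostR_set_eq (z : List ℝ) (x : List ℚ) {i : ℕ} (hi : i < z.length)
    (p : List (ℕ × ℕ)) :
    ∃ (b : ℚ) (c : ℝ), ∀ t : ℝ, alignCostR (z.set i t) (x.map (fun a : ℚ => (a : ℝ))) p =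
      (p.countP (fun q => q.1 - 1 = i) : ℕ) * t ^ 2 - 2 * b * t + c := by
  induction p with
  | nil => exact ⟨0, 0, fun t => by simp [alignCostR]⟩
  | cons q p ih =>
    obtain ⟨b, c, h⟩ := ih
    have hy : (x.map (fun a : ℚ => (a : ℝ))).getD (q.2 - 1) 0 = (x.getD (q.2 - 1) 0 : ℚ) := by
      rw [← Rat.cast_zero, List.getD_map]
    by_cases hq : q.1 - 1 = i
    · refine ⟨b + x.getD (q.2 - 1) 0, c + (x.getD (q.2 - 1) 0 : ℚ) ^ 2, fun t => ?_⟩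
      have hz : (z.set i t).getD (q.1 - 1) 0 = t := by
        simp [List.getD_eq_getElem?_getD, hq, hi]
      have h := h t
      rw [alignCostR] at h ⊢
      rw [List.map_cons, List.sum_cons, h, hy, hz, List.countP_cons_of_pos (by simpa using hq)]
      push_cast
      ring
    · refine ⟨b, c + (z.getD (q.1 - 1) 0 - (x.getD (q.2 - 1) 0 : ℚ)) ^ 2, fun t => ?_⟩
      have hz : (z.set i t).getD (q.1 - 1) 0 = z.getD (q.1 - 1) 0 := by
        simp only [List.getD_eq_getElem?_getD, List.getElem?_set_ne (Ne.symm hq)]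
      have h := h t
      rw [alignCostR] at h ⊢
      rw [List.map_cons, List.sum_cons, h, hy, hz, List.countP_cons_of_neg (by simpa using hq)]
      ring

/-- The minimizer of a quadratic polynomial. -/
theorem eq_div_of_forall_quadratic_le {a b c s : ℝ} (ha : 0 < a)
    (h : ∀ t, a * s ^ 2 - 2 * b * s + c ≤ a * t ^ 2 - 2 * b * t + c) : s = b / a := by
  have hb : b = a * (b / a) := by field_simp
  have h1 : a * (s - b / a) ^ 2 ≤ 0 := by
    have h2 := h (b / a)
    generalize b / a = u at *
    subst hb
    linarith
  have h3 : (s - b / a) ^ 2 = 0 := le_antisymm (nonpos_of_mul_nonpos_right h1 ha) (sq_nonneg _)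
  exact sub_eq_zero.1 (pow_eq_zero_iff two_ne_zero |>.1 h3)

/-- For a sample of nonempty rational time series with positive rational
weights, every real-valued time series minimizing the weighted Fréchet
function over all finite real time series has all entries rational. -/
theorem mean_entries_rational (k : ℕ) (hk : 0 < k) (x : Fin k → List ℚ)
    (hx : ∀ j, x j ≠ []) (w : Fin k → ℚ) (hw : ∀ j, 0 < w j)
    (z : List ℝ) (hz : z ≠ [])
    (hmin : ∀ z' : List ℝ, z' ≠ [] →
      ∑ j : Fin k, (w j : ℝ) * dtwSqR z ((x j).map (fun a : ℚ => (a : ℝ))) ≤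
        ∑ j : Fin k, (w j : ℝ) * dtwSqR z' ((x j).map (fun a : ℚ => (a : ℝ)))) :
    ∀ a ∈ z, ∃ q : ℚ, a = (q : ℝ) := by
  intro a ha
  obtain ⟨i, hi, rfl⟩ := List.mem_iff_getElem.1 ha
  choose p hp hpz using fun j =>
    exists_dtwSqR_eq_alignCostR hz (y := (x j).map (fun a : ℚ => (a : ℝ))) (by simpa using hx j)
  choose b c hbc using fun j => exists_alignCostR_set_eq z (x j) hi (p j)
  let n : Fin k → ℕ := fun j => (p j).countP (fun q => q.1 - 1 = i)
  have hn : ∀ j, 0 < n j := fun j => by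
    obtain ⟨q, hq, hqi⟩ := (hp j).exists_mem_fst_eq (i := i + 1) (by omega) hi
    exact List.countP_pos_iff.2 ⟨q, hq, by simp [hqi]⟩
  have hsum : ∀ t : ℝ, ∑ j, (w j : ℝ) *
      alignCostR (z.set i t) ((x j).map (fun a : ℚ => (a : ℝ))) (p j) =
      (∑ j, w j * n j : ℚ) * t ^ 2 - 2 * (∑ j, w j * b j : ℚ) * t + ∑ j, w j * c j := fun t => by
    push_cast
    rw [Finset.mul_sum, Finset.sum_mul, Finset.sum_mul, ← Finset.sum_sub_distrib,
      ← Finset.sum_add_distrib]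
    refine Finset.sum_congr rfl fun j _ => ?_
    rw [hbc]
    ring
  have hpos : 0 < ∑ j, w j * n j :=
    Finset.sum_pos (fun j _ => mul_pos (hw j) (Nat.cast_pos.2 (hn j))) ⟨⟨0, hk⟩, Finset.mem_univ _⟩
  refine ⟨(∑ j, w j * b j) / ∑ j, w j * n j, ?_⟩
  rw [Rat.cast_div]
  refine eq_div_of_forall_quadratic_le (c := ∑ j, w j * c j) (Rat.cast_pos.2 hpos) fun t => ?_
  rw [← hsum, ← hsum, List.set_getElem_self]
  simp only [← hpz]
  refine (hmin (z.set i t) (by simpa using hz)).trans (Finset.sum_le_sum fun j _ => ?_)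
  exact mul_le_mul_of_nonneg_left (dtwSqR_le_alignCostR (by simpa using hp j))
    (Rat.cast_nonneg.2 (hw j).le)
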